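/- The optimal value is strictly decreasing in the shift d: for all 0 < d₁ < d₂, if σ₁ maximizes σ ↦ V(σ, d₁) over (0, ∞) and σ₂ maximizes σ ↦ V(σ, d₂) over (0, ∞), then V(σ₂, d₂) < V(σ₁, d₁). -/

import Mathlib

open Real MeasureTheory

/-- Gaussian density with mean 0 and standard deviation `σ`. -/
noncomputable def gauss (σ x : ℝ) : ℝ :=
  (1 / (σ * Real.sqrt (2 * Real.pi))) * Real.exp (-x ^ 2 / (2 * σ ^ 2))

/-- The value function determined by the Q-function `Q₀` shifted by `d`. -/
noncomputable def V (Q₀ : ℝ → ℝ) (σ d : ℝ) : ℝ := ∫ x, gauss σ x * Q₀ (x - d)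

theorem gauss_lt_gauss {σ x y : ℝ} (hσ : 0 < σ) (hx : 0 ≤ x) (hxy : x < y) :
    gauss σ y < gauss σ x := by
  unfold gauss
  gcongr

theorem integrable_gauss {σ : ℝ} (hσ : 0 < σ) : Integrable (gauss σ) := by
  have hb : 0 < 1 / (2 * σ ^ 2) := by positivity
  refine ((integrable_exp_neg_mul_sq hb).const_mul (1 / (σ * √(2 * π)))).congr
    (Filter.Eventually.of_forall fun x => ?_)
  simp only [gauss]
  congr 2
  ring

theorem V_eq_integral_add (Q₀ : ℝ → ℝ) (σ d : ℝ) :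
    V Q₀ σ d = ∫ x, gauss σ (x + d) * Q₀ x := by
  rw [V, ← integral_add_right_eq_self _ d]
  simp

theorem integrable_gauss_add_mul {Q₀ : ℝ → ℝ} (hQmeas : Measurable Q₀)
    (hQbdd : ∃ C : ℝ, ∀ x, Q₀ x ≤ C) (hQnonneg : ∀ x, 0 ≤ Q₀ x)
    {σ : ℝ} (hσ : 0 < σ) (d : ℝ) : Integrable fun x => gauss σ (x + d) * Q₀ x := by
  obtain ⟨C, hC⟩ := hQbdd
  refine ((integrable_gauss hσ).comp_add_right d).mul_bdd (c := C) hQmeas.aestronglyMeasurable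
    (Filter.Eventually.of_forall fun x => ?_)
  rw [Real.norm_of_nonneg (hQnonneg x)]
  exact hC x

/-- For a fixed standard deviation, the value strictly decreases with the shift when `Q₀` lives on
the nonnegative half-line. -/
theorem V_lt_V_of_lt {Q₀ : ℝ → ℝ} (hQmeas : Measurable Q₀)
    (hQbdd : ∃ C : ℝ, ∀ x, Q₀ x ≤ C) (hQnonneg : ∀ x, 0 ≤ Q₀ x)
    (hQsupp : ∀ x < 0, Q₀ x = 0) (hQne : ¬ (Q₀ =ᵐ[volume] 0))
    {σ d₁ d₂ : ℝ} (hσ : 0 < σ) (hd₁ : 0 ≤ d₁) (hd : d₁ < d₂) :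
    V Q₀ σ d₂ < V Q₀ σ d₁ := by
  have hint := integrable_gauss_add_mul hQmeas hQbdd hQnonneg hσ
  have hgauss : ∀ x, 0 ≤ x → gauss σ (x + d₂) < gauss σ (x + d₁) := fun x hx =>
    gauss_lt_gauss hσ (by linarith) (by linarith)
  have hle : ∀ x, gauss σ (x + d₂) * Q₀ x ≤ gauss σ (x + d₁) * Q₀ x := fun x => by
    rcases lt_or_ge x 0 with hx | hx
    · simp [hQsupp x hx]
    · exact mul_le_mul_of_nonneg_right (hgauss x hx).le (hQnonneg x)
  rw [V_eq_integral_add, V_eq_integral_add]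
  refine (integral_mono (hint d₂) (hint d₁) hle).lt_of_ne fun heq => hQne ?_
  have hae := (integral_eq_iff_of_ae_le (hint d₂) (hint d₁)
    (Filter.Eventually.of_forall hle)).1 heq
  filter_upwards [hae] with x hx
  rcases lt_or_ge x 0 with hx0 | hx0
  · exact hQsupp x hx0
  · by_contra hne
    exact (hgauss x hx0).ne (mul_right_cancel₀ hne hx)

theorem optimal_value_strictAnti_in_shift (w : ℝ) (hw : 0 < w) (Q₀ : ℝ → ℝ)
    (hQmeas : Measurable Q₀) (hQbdd : ∃ C : ℝ, ∀ x, Q₀ x ≤ C)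
    (hQnonneg : ∀ x, 0 ≤ Q₀ x)
    (hQsupp : ∀ x, x ∉ Set.Icc 0 w → Q₀ x = 0)
    (hQne : ¬ (Q₀ =ᵐ[volume] 0))
    (d₁ d₂ : ℝ) (hd₁ : 0 < d₁) (hd : d₁ < d₂)
    (σ₁ σ₂ : ℝ) (hσ₁ : 0 < σ₁) (hσ₂ : 0 < σ₂)
    (hmax₁ : ∀ σ : ℝ, 0 < σ → V Q₀ σ d₁ ≤ V Q₀ σ₁ d₁)
    (hmax₂ : ∀ σ : ℝ, 0 < σ → V Q₀ σ d₂ ≤ V Q₀ σ₂ d₂) :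
    V Q₀ σ₂ d₂ < V Q₀ σ₁ d₁ := by
  have hlt : V Q₀ σ₂ d₂ < V Q₀ σ₂ d₁ :=
    V_lt_V_of_lt hQmeas hQbdd hQnonneg (fun x hx => hQsupp x fun h => hx.not_ge h.1) hQne
      hσ₂ hd₁.le hd
  exact hlt.trans_le (hmax₁ σ₂ hσ₂)
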